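/- Let A be a real 2n×2n symmetric negative semidefinite matrix and let l > 0 (the wheelbase). Let q : ℝ → (ℝ²)ⁿ, θ : ℝ → ℝⁿ, δ : ℝ → ℝⁿ be continuously differentiable and suppose that for every agent i and all t ≥ 0, with gᵢ := (cos δᵢ, sin δᵢ), gᵢ⊥ := (−sin δᵢ, cos δᵢ), hᵢ⊥ := (−sin θᵢ, cos θᵢ), and uᵢ := (A q(t))ᵢ, the front-wheel drive car closed-loop dynamics hold: q̇ᵢ = ⟨gᵢ, uᵢ⟩·gᵢ, θ̇ᵢ = (1/l)·⟨hᵢ⊥, gᵢ⟩·⟨gᵢ, uᵢ⟩, and δ̇ᵢ = (1/l)·⟨hᵢ⊥, gᵢ⟩·⟨gᵢ, uᵢ⟩ + ⟨gᵢ⊥, uᵢ⟩. Then dist(q(t), ker A) → 0 as t → ∞. -/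

import Mathlib

open Filter Matrix

/-- Boundedness on the half line `[0, ∞)`. -/
def Bd (f : ℝ → ℝ) : Prop := ∃ C : ℝ, ∀ t : ℝ, 0 ≤ t → |f t| ≤ C

lemma Bd.add {f g : ℝ → ℝ} (hf : Bd f) (hg : Bd g) : Bd (fun t => f t + g t) := by
  obtain ⟨C, hC⟩ := hf
  obtain ⟨D, hD⟩ := hg
  exact ⟨C + D, fun t ht => (abs_add_le _ _).trans (add_le_add (hC t ht) (hD t ht))⟩

lemma Bd.mul {f g : ℝ → ℝ} (hf : Bd f) (hg : Bd g) : Bd (fun t => f t * g t) := by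
  obtain ⟨C, hC⟩ := hf
  obtain ⟨D, hD⟩ := hg
  refine ⟨C * D, fun t ht => ?_⟩
  rw [abs_mul]
  exact mul_le_mul (hC t ht) (hD t ht) (abs_nonneg _) ((abs_nonneg _).trans (hC t ht))

lemma Bd.neg {f : ℝ → ℝ} (hf : Bd f) : Bd (fun t => - f t) := by
  obtain ⟨C, hC⟩ := hf
  exact ⟨C, fun t ht => by rw [abs_neg]; exact hC t ht⟩

lemma Bd.const (c : ℝ) : Bd (fun _ => c) := ⟨|c|, fun _ _ => le_rfl⟩

lemma Bd.cos (f : ℝ → ℝ) : Bd (fun t => Real.cos (f t)) := ⟨1, fun _ _ => Real.abs_cos_le_one _⟩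

lemma Bd.sin (f : ℝ → ℝ) : Bd (fun t => Real.sin (f t)) := ⟨1, fun _ _ => Real.abs_sin_le_one _⟩

lemma Bd.sum {ι : Type*} (s : Finset ι) (f : ι → ℝ → ℝ) (hf : ∀ i, Bd (f i)) :
    Bd (fun t => ∑ i ∈ s, f i t) := by
  choose C hC using hf
  exact ⟨∑ i ∈ s, C i, fun t ht =>
    (Finset.abs_sum_le_sum_abs _ _).trans (Finset.sum_le_sum fun i _ => hC i t ht)⟩

lemma Bd.mul_tendsto {f g : ℝ → ℝ} (hf : Bd f) (hg : Tendsto g atTop (nhds 0)) :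
    Tendsto (fun t => f t * g t) atTop (nhds 0) := by
  obtain ⟨C, hC⟩ := hf
  have h1 : Tendsto (fun t => C * |g t|) atTop (nhds 0) := by
    simpa using (hg.abs).const_mul C
  refine squeeze_zero_norm' ?_ h1
  filter_upwards [eventually_ge_atTop 0] with t ht
  rw [Real.norm_eq_abs, abs_mul]
  exact mul_le_mul_of_nonneg_right (hC t ht) (abs_nonneg _)

/-- A version of Barbalat's lemma with a vanishing perturbation. -/
lemma barbalat (F f f' e : ℝ → ℝ) (a : ℝ)
    (hF : ∀ t, 0 ≤ t → HasDerivAt F (f t + e t) t)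
    (hFl : Tendsto F atTop (nhds a)) (he : Tendsto e atTop (nhds 0))
    (hf : ∀ t, 0 ≤ t → HasDerivAt f (f' t) t) (hb : Bd f') :
    Tendsto f atTop (nhds 0) := by
  obtain ⟨L0, hL0⟩ := hb
  obtain ⟨L, hL, hLp⟩ : ∃ L : ℝ, (∀ t, 0 ≤ t → |f' t| ≤ L) ∧ 0 < L :=
    ⟨|L0| + 1, fun t ht => (hL0 t ht).trans ((le_abs_self _).trans (by linarith)), by positivity⟩
  rw [Metric.tendsto_atTop]
  intro ε hε
  set h : ℝ := ε / (4 * L) with hh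
  have hhp : 0 < h := by positivity
  have hLh : L * h = ε / 4 := by rw [hh]; field_simp
  obtain ⟨N1, hN1⟩ := Metric.tendsto_atTop.1 hFl (ε * h / 8) (by positivity)
  obtain ⟨N2, hN2⟩ := Metric.tendsto_atTop.1 he (ε / 4) (by positivity)
  refine ⟨max 0 (max N1 N2), fun t ht => ?_⟩
  have ht0 : 0 ≤ t := (le_max_left _ _).trans ht
  have ht1 : N1 ≤ t := (le_max_left _ _).trans ((le_max_right _ _).trans ht)
  have ht2 : N2 ≤ t := (le_max_right _ _).trans ((le_max_right _ _).trans ht)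
  obtain ⟨c, ⟨hc1, hc2⟩, hc⟩ := exists_hasDerivAt_eq_slope F (fun x => f x + e x)
    (show t < t + h by linarith)
    (fun x hx => (hF x (ht0.trans hx.1)).continuousAt.continuousWithinAt)
    (fun x hx => hF x (ht0.trans hx.1.le))
  obtain ⟨d, ⟨hd1, hd2⟩, hd⟩ := exists_hasDerivAt_eq_slope f f' hc1
    (fun x hx => (hf x (ht0.trans hx.1)).continuousAt.continuousWithinAt)
    (fun x hx => hf x (ht0.trans hx.1.le))
  have e1 := hN1 t ht1
  have e2 := hN1 (t + h) (by linarith)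
  have e3 := hN2 c (by linarith)
  have e4 := hL d (by linarith)
  simp only [Real.dist_eq, sub_zero] at e1 e2 e3 ⊢
  have hct : 0 < c - t := by linarith
  rw [eq_div_iff hct.ne'] at hd
  rw [add_sub_cancel_left, eq_div_iff hhp.ne'] at hc
  have e5 : |f c - f t| ≤ ε / 4 := by
    rw [← hd, abs_mul, abs_of_pos hct, ← hLh]
    exact mul_le_mul e4 (by linarith) hct.le hLp.le
  have e6 : |f c + e c| < ε / 4 := by
    have : |f c + e c| * h < ε / 4 * h := by
      rw [← abs_of_pos hhp, ← abs_mul, abs_of_pos hhp, hc]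
      rw [abs_lt] at e1 e2 ⊢
      constructor <;> linarith [e1.1, e1.2, e2.1, e2.2]
    exact lt_of_mul_lt_mul_right this hhp.le
  rw [abs_lt] at e3 e6 ⊢
  rw [abs_le] at e5
  constructor <;> linarith [e3.1, e3.2, e6.1, e6.2, e5.1, e5.2]

lemma dot_mulVec_comm {ι : Type*} [Fintype ι] (A : Matrix ι ι ℝ) (hs : A.IsSymm)
    (x y : ι → ℝ) : x ⬝ᵥ A.mulVec y = y ⬝ᵥ A.mulVec x := by
  rw [dotProduct_mulVec, ← mulVec_transpose, hs.eq, dotProduct_comm]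

lemma cs_nsd {ι : Type*} [Fintype ι] [DecidableEq ι] (A : Matrix ι ι ℝ) (hs : A.IsSymm)
    (hn : ∀ w : ι → ℝ, w ⬝ᵥ A.mulVec w ≤ 0) (x : ι → ℝ) (j : ι) :
    (A.mulVec x j) ^ 2 ≤ A j j * (x ⬝ᵥ A.mulVec x) := by
  set w : ι → ℝ := Pi.single j 1 with hw
  have h1 : w ⬝ᵥ A.mulVec x = A.mulVec x j := by simp [hw]
  have h2 : x ⬝ᵥ A.mulVec w = A.mulVec x j := by rw [dot_mulVec_comm A hs, h1]
  have h3 : w ⬝ᵥ A.mulVec w = A j j := by simp [hw]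
  have key : ∀ y : ℝ, 0 ≤ (-(A j j)) * (y * y) + (-2 * A.mulVec x j) * y
      + (-(x ⬝ᵥ A.mulVec x)) := by
    intro y
    have := hn (x + y • w)
    rw [mulVec_add, mulVec_smul, add_dotProduct, dotProduct_add, dotProduct_add,
      dotProduct_smul, smul_dotProduct, smul_dotProduct, dotProduct_smul, h1, h2, h3] at this
    simp only [smul_eq_mul] at this
    linarith
  have := discrim_le_zero key
  rw [discrim] at this
  linarith

lemma infDist_ker_tendsto {ι : Type*} [Fintype ι] [DecidableEq ι] (A : Matrix ι ι ℝ)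
    (q : ℝ → EuclideanSpace ℝ ι)
    (h : ∀ j, Tendsto (fun t => A.mulVec (q t) j) atTop (nhds 0)) :
    Tendsto (fun t => Metric.infDist (q t) {x : EuclideanSpace ℝ ι | A.mulVec x = 0})
      atTop (nhds 0) := by
  let T : EuclideanSpace ℝ ι →ₗ[ℝ] (ι → ℝ) :=
    A.mulVecLin ∘ₗ (WithLp.linearEquiv 2 ℝ (ι → ℝ)).toLinearMap
  have hT : ∀ x, T x = A.mulVec x := fun x => rfl
  obtain ⟨S, hS⟩ := T.rangeRestrict.exists_rightInverse_of_surjective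
    (LinearMap.range_rangeRestrict T)
  have hS' : ∀ x, T (S (T.rangeRestrict x)) = T x := by
    intro x
    have := LinearMap.congr_fun hS (T.rangeRestrict x)
    exact congrArg Subtype.val this
  have hSc : Continuous S := S.continuous_of_finiteDimensional
  have h0 : Tendsto (fun t => T.rangeRestrict (q t)) atTop (nhds 0) := by
    rw [tendsto_subtype_rng]
    exact tendsto_pi_nhds.2 h
  have h1 : Tendsto (fun t => ‖S (T.rangeRestrict (q t))‖) atTop (nhds 0) := by
    have := ((hSc.tendsto 0).comp h0).norm
    simpa using this
  refine squeeze_zero (fun t => Metric.infDist_nonneg) (fun t => ?_) h1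
  have hmem : q t - S (T.rangeRestrict (q t)) ∈ {x : EuclideanSpace ℝ ι | A.mulVec x = 0} := by
    show A.mulVec _ = 0
    rw [← hT, map_sub, hS', sub_self]
  refine (Metric.infDist_le_dist_of_mem hmem).trans ?_
  rw [dist_eq_norm, sub_sub_cancel]

lemma pow_eq_zero_iff_tendsto {f : ℝ → ℝ} (h : Tendsto (fun t => f t ^ 2) atTop (nhds 0)) :
    Tendsto f atTop (nhds 0) := by
  have h1 := (Real.continuous_sqrt.tendsto 0).comp h
  rw [Real.sqrt_zero] at h1
  refine (tendsto_zero_iff_abs_tendsto_zero _).2 (h1.congr fun t => ?_)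
  exact Real.sqrt_sq_eq_abs _

/-- Under the front-wheel drive car closed-loop dynamics
`q̇ᵢ = ⟨gᵢ, uᵢ⟩ gᵢ`, `θ̇ᵢ = (1/l) ⟨hᵢ⊥, gᵢ⟩ ⟨gᵢ, uᵢ⟩`,
`δ̇ᵢ = (1/l) ⟨hᵢ⊥, gᵢ⟩ ⟨gᵢ, uᵢ⟩ + ⟨gᵢ⊥, uᵢ⟩` with `uᵢ = (A q)ᵢ` and `A` symmetric negative
semidefinite, `dist (q t, ker A) → 0`. -/
theorem front_wheel_car_converges
    (n : ℕ) (A : Matrix (Fin n × Fin 2) (Fin n × Fin 2) ℝ)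
    (hsymm : A.IsSymm) (hnsd : ∀ w : Fin n × Fin 2 → ℝ, w ⬝ᵥ A.mulVec w ≤ 0)
    (l : ℝ) (hl : 0 < l)
    (q : ℝ → EuclideanSpace ℝ (Fin n × Fin 2)) (θ : ℝ → Fin n → ℝ) (δ : ℝ → Fin n → ℝ)
    (hq : ContDiff ℝ 1 q) (hθ : ContDiff ℝ 1 θ) (hδ : ContDiff ℝ 1 δ)
    (hdyn : ∀ t : ℝ, 0 ≤ t → ∀ i : Fin n,
      HasDerivAt (fun s => q s (i, 0))
        ((Real.cos (δ t i) * A.mulVec (q t) (i, 0) +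
          Real.sin (δ t i) * A.mulVec (q t) (i, 1)) * Real.cos (δ t i)) t ∧
      HasDerivAt (fun s => q s (i, 1))
        ((Real.cos (δ t i) * A.mulVec (q t) (i, 0) +
          Real.sin (δ t i) * A.mulVec (q t) (i, 1)) * Real.sin (δ t i)) t ∧
      HasDerivAt (fun s => θ s i)
        ((1 / l) * (-Real.sin (θ t i) * Real.cos (δ t i) +
            Real.cos (θ t i) * Real.sin (δ t i)) *
          (Real.cos (δ t i) * A.mulVec (q t) (i, 0) +
            Real.sin (δ t i) * A.mulVec (q t) (i, 1))) t ∧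
      HasDerivAt (fun s => δ s i)
        ((1 / l) * (-Real.sin (θ t i) * Real.cos (δ t i) +
            Real.cos (θ t i) * Real.sin (δ t i)) *
          (Real.cos (δ t i) * A.mulVec (q t) (i, 0) +
            Real.sin (δ t i) * A.mulVec (q t) (i, 1)) +
          (-Real.sin (δ t i) * A.mulVec (q t) (i, 0) +
            Real.cos (δ t i) * A.mulVec (q t) (i, 1))) t) :
    Tendsto (fun t => Metric.infDist (q t)
        {x : EuclideanSpace ℝ (Fin n × Fin 2) | A.mulVec x = 0}) atTop (nhds 0) := by
  apply infDist_ker_tendsto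
  set u : ℝ → Fin n × Fin 2 → ℝ := fun t => A.mulVec (q t) with hu
  set s : Fin n → ℝ → ℝ := fun i t =>
    Real.cos (δ t i) * u t (i, 0) + Real.sin (δ t i) * u t (i, 1) with hs
  set p : Fin n → ℝ → ℝ := fun i t =>
    -Real.sin (δ t i) * u t (i, 0) + Real.cos (δ t i) * u t (i, 1) with hp
  set r : Fin n → ℝ → ℝ := fun i t =>
    (1 / l) * (-Real.sin (θ t i) * Real.cos (δ t i) +
            Real.cos (θ t i) * Real.sin (δ t i)) with hr
  set v : ℝ → Fin n × Fin 2 → ℝ := fun t j =>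
    s j.1 t * (if j.2 = 0 then Real.cos (δ t j.1) else Real.sin (δ t j.1)) with hv
  set w : ℝ → Fin n × Fin 2 → ℝ := fun t => A.mulVec (v t) with hw
  have hdδ : ∀ i t, 0 ≤ t → HasDerivAt (fun x => δ x i) (r i t * s i t + p i t) t :=
    fun i t ht => (hdyn t ht i).2.2.2
  have hdq : ∀ j t, 0 ≤ t → HasDerivAt (fun x => q x j) (v t j) t := by
    rintro ⟨i, k⟩ t ht
    fin_cases k
    · exact (hdyn t ht i).1
    · exact (hdyn t ht i).2.1
  have hdu : ∀ j t, 0 ≤ t → HasDerivAt (fun x => u x j) (w t j) t := by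
    intro j t ht
    exact HasDerivAt.fun_sum fun k _ => (hdq k t ht).const_mul (A j k)
  have hvu : ∀ t, v t ⬝ᵥ u t = ∑ i, s i t ^ 2 := by
    intro t
    rw [dotProduct, Fintype.sum_prod_type]
    refine Finset.sum_congr rfl fun i _ => ?_
    rw [Fin.sum_univ_two]
    simp only [hv, hs, if_true, one_ne_zero, if_false]
    ring
  have hdV : ∀ t, 0 ≤ t → HasDerivAt (fun x => (q x : Fin n × Fin 2 → ℝ) ⬝ᵥ u x)
      (2 * ∑ i, s i t ^ 2) t := by
    intro t ht
    have h1 : HasDerivAt (fun x => (q x : Fin n × Fin 2 → ℝ) ⬝ᵥ u x)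
        (∑ j, (v t j * u t j + q t j * w t j)) t :=
      HasDerivAt.fun_sum fun j _ => (hdq j t ht).mul (hdu j t ht)
    have h2 : ∑ j, (v t j * u t j + q t j * w t j) = 2 * ∑ i, s i t ^ 2 := by
      rw [Finset.sum_add_distrib]
      change v t ⬝ᵥ u t + (q t : Fin n × Fin 2 → ℝ) ⬝ᵥ A.mulVec (v t) = _
      rw [dot_mulVec_comm A hsymm (q t) (v t)]
      change v t ⬝ᵥ u t + v t ⬝ᵥ u t = _
      rw [hvu]
      ring
    rwa [h2] at h1
  set V : ℝ → ℝ := fun x => (q x : Fin n × Fin 2 → ℝ) ⬝ᵥ u x with hV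
  have hmono : MonotoneOn V (Set.Ici 0) := by
    refine monotoneOn_of_hasDerivWithinAt_nonneg (f' := fun t => 2 * ∑ i, s i t ^ 2)
      (convex_Ici 0)
      (fun x hx => (hdV x hx).continuousAt.continuousWithinAt) (fun x hx => ?_) (fun x hx => ?_)
    · rw [interior_Ici] at hx
      exact (hdV x (le_of_lt hx)).hasDerivWithinAt
    · positivity
  have hV0 : ∀ t, V t ≤ 0 := fun t => hnsd _
  obtain ⟨a, ha⟩ : ∃ a, Tendsto V atTop (nhds a) := by
    have hm : Monotone (fun t => V (max t 0)) := fun x y hxy =>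
      hmono (le_max_right x 0) (le_max_right y 0) (max_le_max hxy le_rfl)
    refine ⟨_, (tendsto_atTop_ciSup hm ⟨0, ?_⟩).congr' ?_⟩
    · rintro _ ⟨x, rfl⟩
      exact hV0 _
    · filter_upwards [eventually_ge_atTop 0] with t ht
      rw [max_eq_left ht]
  have bu : ∀ j, Bd (fun t => u t j) := by
    intro j
    refine ⟨Real.sqrt (A j j * V 0), fun t ht => Real.abs_le_sqrt ?_⟩
    have h1 := cs_nsd A hsymm hnsd (q t) j
    refine h1.trans (mul_le_mul_of_nonpos_left (hmono Set.self_mem_Ici ht ht) ?_)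
    have := hnsd (Pi.single j 1)
    simpa using this
  have bs : ∀ i, Bd (s i) := fun i =>
    ((Bd.cos _).mul (bu (i, 0))).add ((Bd.sin _).mul (bu (i, 1)))
  have bp : ∀ i, Bd (p i) := fun i =>
    ((Bd.sin _).neg.mul (bu (i, 0))).add ((Bd.cos _).mul (bu (i, 1)))
  have br : ∀ i, Bd (r i) := fun i =>
    (Bd.const _).mul (((Bd.sin _).neg.mul (Bd.cos _)).add ((Bd.cos _).mul (Bd.sin _)))
  have bc : ∀ j : Fin n × Fin 2,
      Bd (fun t => if j.2 = 0 then Real.cos (δ t j.1) else Real.sin (δ t j.1)) := by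
    intro j
    by_cases h : j.2 = 0
    · simp only [h, if_true]; exact Bd.cos _
    · simp only [h, if_false]; exact Bd.sin _
  have bv : ∀ j, Bd (fun t => v t j) := fun j => (bs j.1).mul (bc j)
  have bw : ∀ j, Bd (fun t => w t j) := fun j =>
    Bd.sum Finset.univ (fun k t => A j k * v t k) fun k => (Bd.const _).mul (bv k)
  have hds : ∀ i t, 0 ≤ t → HasDerivAt (s i) ((r i t * s i t + p i t) * p i t +
      (Real.cos (δ t i) * w t (i, 0) + Real.sin (δ t i) * w t (i, 1))) t := by
    intro i t ht
    have h1 := ((hdδ i t ht).cos.mul (hdu (i, 0) t ht)).add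
      ((hdδ i t ht).sin.mul (hdu (i, 1) t ht))
    refine h1.congr_deriv ?_
    simp only [hp]
    ring
  have hdp : ∀ i t, 0 ≤ t → HasDerivAt (p i) (-((r i t * s i t + p i t) * s i t) +
      (-Real.sin (δ t i) * w t (i, 0) + Real.cos (δ t i) * w t (i, 1))) t := by
    intro i t ht
    have h1 := ((hdδ i t ht).sin.fun_neg.mul (hdu (i, 0) t ht)).add
      ((hdδ i t ht).cos.mul (hdu (i, 1) t ht))
    refine h1.congr_deriv ?_
    simp only [hs]
    ring
  have bds : ∀ i, Bd (fun t => (r i t * s i t + p i t) * p i t +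
      (Real.cos (δ t i) * w t (i, 0) + Real.sin (δ t i) * w t (i, 1))) := fun i =>
    ((((br i).mul (bs i)).add (bp i)).mul (bp i)).add
      (((Bd.cos _).mul (bw (i, 0))).add ((Bd.sin _).mul (bw (i, 1))))
  have bdp : ∀ i, Bd (fun t => -((r i t * s i t + p i t) * s i t) +
      (-Real.sin (δ t i) * w t (i, 0) + Real.cos (δ t i) * w t (i, 1))) := fun i =>
    ((((br i).mul (bs i)).add (bp i)).mul (bs i)).neg.add
      (((Bd.sin _).neg.mul (bw (i, 0))).add ((Bd.cos _).mul (bw (i, 1))))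
  -- first application: all `s i` tend to zero
  have hsum : Tendsto (fun t => 2 * ∑ i, s i t ^ 2) atTop (nhds 0) := by
    refine barbalat V _ (fun t => 2 * ∑ i, (2 * s i t) * ((r i t * s i t + p i t) * p i t +
      (Real.cos (δ t i) * w t (i, 0) + Real.sin (δ t i) * w t (i, 1)))) (fun _ => 0) a
      (fun t ht => by simpa using hdV t ht) ha tendsto_const_nhds (fun t ht => ?_) ?_
    · refine HasDerivAt.const_mul 2 (HasDerivAt.fun_sum fun i _ => ?_)
      simpa using (hds i t ht).fun_pow 2
    · exact (Bd.const 2).mul (Bd.sum Finset.univ _ fun i =>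
        ((Bd.const 2).mul (bs i)).mul (bds i))
  have ts : ∀ i, Tendsto (s i) atTop (nhds 0) := by
    intro i
    have h1 : Tendsto (fun t => s i t ^ 2) atTop (nhds 0) := by
      refine squeeze_zero (fun t => sq_nonneg _) (fun t => ?_) hsum
      have h2 : s i t ^ 2 ≤ ∑ i, s i t ^ 2 :=
        Finset.single_le_sum (f := fun i => s i t ^ 2) (fun i _ => sq_nonneg _) (Finset.mem_univ i)
      have h3 := sq_nonneg (s i t)
      linarith
    exact (pow_eq_zero_iff_tendsto h1)
  have tv : ∀ j, Tendsto (fun t => v t j) atTop (nhds 0) := fun j =>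
    ((bc j).mul_tendsto (ts j.1)).congr fun t => mul_comm _ _
  have tw : ∀ j, Tendsto (fun t => w t j) atTop (nhds 0) := by
    intro j
    have : Tendsto (fun t => ∑ k, A j k * v t k) atTop (nhds (∑ k, A j k * 0)) :=
      tendsto_finsetSum _ fun k _ => (tv k).const_mul _
    simp only [mul_zero, Finset.sum_const_zero] at this
    exact this
  -- second application: all `p i` tend to zero
  have tp : ∀ i, Tendsto (p i) atTop (nhds 0) := by
    intro i
    refine pow_eq_zero_iff_tendsto (barbalat (s i) (fun t => p i t ^ 2)
      (fun t => (2 * p i t) * (-((r i t * s i t + p i t) * s i t) +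
        (-Real.sin (δ t i) * w t (i, 0) + Real.cos (δ t i) * w t (i, 1))))
      (fun t => (r i t * p i t) * s i t +
        (Real.cos (δ t i) * w t (i, 0) + Real.sin (δ t i) * w t (i, 1))) 0
      (fun t ht => (hds i t ht).congr_deriv (by ring)) (ts i) ?_ (fun t ht => ?_) ?_)
    · have h1 := (((br i).mul (bp i)).mul_tendsto (ts i)).add
        (((Bd.cos (fun t => δ t i)).mul_tendsto (tw (i, 0))).add
          ((Bd.sin (fun t => δ t i)).mul_tendsto (tw (i, 1))))
      simpa using h1
    · simpa using (hdp i t ht).fun_pow 2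
    · exact ((Bd.const 2).mul (bp i)).mul (bdp i)
  rintro ⟨i, k⟩
  fin_cases k
  · have h1 := ((Bd.cos (fun t => δ t i)).mul_tendsto (ts i)).add
      ((Bd.sin (fun t => δ t i)).neg.mul_tendsto (tp i))
    rw [add_zero] at h1
    refine h1.congr fun t => ?_
    show _ = u t (i, 0)
    simp only [hs, hp]
    linear_combination (u t (i, 0)) * Real.sin_sq_add_cos_sq (δ t i)
  · have h1 := ((Bd.sin (fun t => δ t i)).mul_tendsto (ts i)).add
      ((Bd.cos (fun t => δ t i)).mul_tendsto (tp i))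
    rw [add_zero] at h1
    refine h1.congr fun t => ?_
    show _ = u t (i, 1)
    simp only [hs, hp]
    linear_combination (u t (i, 1)) * Real.sin_sq_add_cos_sq (δ t i)
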